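/- The following are equivalent for two faces F, G of 𝒜: (1) F ≤ G in the facial weak order FW(𝒜,B); (2) there exists a finite sequence of faces F = F_1, F_2, …, F_n = G such that for each i, |dim F_i − dim F_{i+1}| = 1 and either (F_i ⊆ F_{i+1} and M_{F_i} = M_{F_{i+1}}) or (F_{i+1} ⊆ F_i and m_{F_i} = m_{F_{i+1}}); (3) F ⪯ G in the covector order, i.e. G(H) ≤ F(H) for all H ∈ 𝒜. -/

import Mathlib

open scoped RealInnerProductSpace Pointwise

variable {V : Type*} [NormedAddCommGroup V] [InnerProductSpace ℝ V] [FiniteDimensional ℝ V]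
  {ι : Type*} [Fintype ι]

/-- The (open) complement of the union of the hyperplanes with chosen normals `e i`. -/
def arrComplement (e : ι → V) : Set V := {v | ∀ i, ⟪e i, v⟫ ≠ 0}

/-- A region of the arrangement: the closure of a connected component of the complement
of the union of the hyperplanes. -/
def IsRegion (e : ι → V) (R : Set V) : Prop :=
  ∃ x ∈ arrComplement e, R = closure (connectedComponentIn (arrComplement e) x)

/-- The positive closed half-space bounded by the hyperplane with normal `e i`. -/
def posHalf (e : ι → V) (i : ι) : Set V := {v | 0 ≤ ⟪e i, v⟫}

/-- The negative closed half-space bounded by the hyperplane with normal `e i`. -/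
def negHalf (e : ι → V) (i : ι) : Set V := {v | ⟪e i, v⟫ ≤ 0}

/-- The separation set of two regions: the (indices of) hyperplanes such that the two
regions lie in opposite closed half-spaces. -/
def sepSet (e : ι → V) (R R' : Set V) : Set ι :=
  {i | (R ⊆ posHalf e i ∧ R' ⊆ negHalf e i) ∨ (R ⊆ negHalf e i ∧ R' ⊆ posHalf e i)}

/-- The order of the poset of regions `PR(𝒜,B)`. -/
def PRle (e : ι → V) (B R R' : Set V) : Prop := sepSet e B R ⊆ sepSet e B R'

/-- Strict order of the poset of regions. -/
def PRlt (e : ι → V) (B R R' : Set V) : Prop := PRle e B R R' ∧ R ≠ R'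

/-- Cover relation in the poset of regions. -/
def PRcover (e : ι → V) (B R R' : Set V) : Prop :=
  PRlt e B R R' ∧ ¬ ∃ U, IsRegion e U ∧ PRlt e B R U ∧ PRlt e B U R'

/-- A face of the arrangement: an intersection of a nonempty collection of regions. -/
def IsFace (e : ι → V) (F : Set V) : Prop :=
  ∃ Rs : Set (Set V), Rs.Nonempty ∧ (∀ R ∈ Rs, IsRegion e R) ∧ F = ⋂₀ Rs

/-- `[m, M]` is the facial interval of the face `F` in the poset of regions:
the regions containing `F` are exactly those between `m` and `M`. -/
def IsFacialInterval (e : ι → V) (B F m M : Set V) : Prop :=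
  IsRegion e m ∧ IsRegion e M ∧
    ∀ R, IsRegion e R → (F ⊆ R ↔ (PRle e B m R ∧ PRle e B R M))

/-- The facial weak order `FW(𝒜,B)`: `F ≤ G` iff `m_F ≤ m_G` and `M_F ≤ M_G`
in the poset of regions. -/
def FWle (e : ι → V) (B F G : Set V) : Prop :=
  ∃ mF MF mG MG, IsFacialInterval e B F mF MF ∧ IsFacialInterval e B G mG MG ∧
    PRle e B mF mG ∧ PRle e B MF MG

/-- Strict facial weak order. -/
def FWlt (e : ι → V) (B F G : Set V) : Prop := FWle e B F G ∧ F ≠ G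

/-- Cover relation in the facial weak order. -/
def FWcover (e : ι → V) (B F G : Set V) : Prop :=
  FWlt e B F G ∧ ¬ ∃ X, IsFace e X ∧ FWlt e B F X ∧ FWlt e B X G

/-- Two faces have the same maximal region `M` of their facial intervals. -/
def SameMax (e : ι → V) (B F G : Set V) : Prop :=
  ∃ m m' M, IsFacialInterval e B F m M ∧ IsFacialInterval e B G m' M

/-- Two faces have the same minimal region `m` of their facial intervals. -/
def SameMin (e : ι → V) (B F G : Set V) : Prop :=
  ∃ m M M', IsFacialInterval e B F m M ∧ IsFacialInterval e B G m M'

/-- The dimension of a face: the dimension of its linear span. -/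
noncomputable def fdim (F : Set V) : ℕ := Module.finrank ℝ (Submodule.span ℝ F)

open Classical in
/-- The covector (sign vector) of a face: the sign of `⟪e i, x⟫` for `x` in the
relative interior of the face. -/
noncomputable def covec (e : ι → V) (F : Set V) (i : ι) : SignType :=
  if ∀ x ∈ intrinsicInterior ℝ F, 0 < ⟪e i, x⟫ then 1
  else if ∀ x ∈ intrinsicInterior ℝ F, ⟪e i, x⟫ < 0 then -1
  else 0

/-- Composition of sign vectors. -/
def scomp (f g : ι → SignType) (i : ι) : SignType := if f i ≠ 0 then f i else g i

/-- The set of roots of the arrangement: the chosen normals and their opposites. -/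
def roots (e : ι → V) : Set V := Set.range e ∪ Set.range (fun i => -(e i))

/-- The root inversion set of a face. -/
def rootInv (e : ι → V) (F : Set V) : Set V :=
  {v ∈ roots e | ∃ x ∈ intrinsicInterior ℝ F, ⟪x, v⟫ ≤ 0}

/-- `H i` is a wall of the region `R`. -/
noncomputable def IsWall (e : ι → V) (R : Set V) (i : ι) : Prop :=
  fdim ({v : V | ⟪e i, v⟫ = 0} ∩ R) = Module.finrank ℝ V - 1

/-- A region is simplicial when the normal vectors of its walls are linearly independent. -/
def IsSimplicialRegion (e : ι → V) (R : Set V) : Prop :=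
  LinearIndependent ℝ (fun i : {i : ι // IsWall e R i} => e i.1)

/-- The arrangement is simplicial when all its regions are. -/
def IsSimplicial (e : ι → V) : Prop := ∀ R, IsRegion e R → IsSimplicialRegion e R

/-- The arrangement is essential when the intersection of all its hyperplanes is `{0}`. -/
def IsEssential (e : ι → V) : Prop := (⋂ i, {v : V | ⟪e i, v⟫ = 0}) = ({0} : Set V)

/-- The poset of regions is a lattice: any two regions have a join and a meet. -/
def PRIsLattice (e : ι → V) (B : Set V) : Prop :=
  ∀ R R', IsRegion e R → IsRegion e R' →
    (∃ J, IsRegion e J ∧ PRle e B R J ∧ PRle e B R' J ∧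
      ∀ U, IsRegion e U → PRle e B R U → PRle e B R' U → PRle e B J U) ∧
    (∃ M, IsRegion e M ∧ PRle e B M R ∧ PRle e B M R' ∧
      ∀ U, IsRegion e U → PRle e B U R → PRle e B U R' → PRle e B U M)

set_option linter.unusedSectionVars false

/-- The closed cone of vectors weakly agreeing in sign with `x` on every hyperplane. -/
def signCone (e : ι → V) (x : V) : Set V :=
  {v | ∀ i, (0 < ⟪e i, x⟫ → 0 ≤ ⟪e i, v⟫) ∧ (⟪e i, x⟫ < 0 → ⟪e i, v⟫ ≤ 0) ∧
    (⟪e i, x⟫ = 0 → ⟪e i, v⟫ = 0)}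

/-- The intersection of the hyperplanes containing `x`. -/
def flatSpan (e : ι → V) (x : V) : Submodule ℝ V where
  carrier := {v | ∀ i, ⟪e i, x⟫ = 0 → ⟪e i, v⟫ = 0}
  add_mem' := by
    intro a b ha hb i hi
    rw [inner_add_right, ha i hi, hb i hi, add_zero]
  zero_mem' := by
    intro i _
    exact inner_zero_right _
  smul_mem' := by
    intro c a ha i hi
    rw [inner_smul_right, ha i hi, mul_zero]

lemma self_mem_signCone (e : ι → V) (x : V) : x ∈ signCone e x :=
  fun _ => ⟨le_of_lt, le_of_lt, id⟩

lemma signCone_subset_of_mem {e : ι → V} {x y : V} (h : x ∈ signCone e y) :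
    signCone e x ⊆ signCone e y := by
  intro v hv i
  obtain ⟨h1, h2, h3⟩ := h i
  obtain ⟨k1, k2, k3⟩ := hv i
  refine ⟨fun hy => ?_, fun hy => ?_, fun hy => k3 (h3 hy)⟩
  · rcases (h1 hy).lt_or_eq with h | h
    · exact k1 h
    · exact (k3 h.symm).ge
  · rcases (h2 hy).lt_or_eq with h | h
    · exact k2 h
    · exact (k3 h).le

lemma signCone_subset_iff {e : ι → V} {x y : V} :
    signCone e x ⊆ signCone e y ↔ x ∈ signCone e y :=
  ⟨fun h => h (self_mem_signCone e x), signCone_subset_of_mem⟩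

lemma isClosed_signCone (e : ι → V) (x : V) : IsClosed (signCone e x) := by
  have : signCone e x = ⋂ i, ({v | 0 < ⟪e i, x⟫ → 0 ≤ ⟪e i, v⟫} ∩
      ({v | ⟪e i, x⟫ < 0 → ⟪e i, v⟫ ≤ 0} ∩ {v | ⟪e i, x⟫ = 0 → ⟪e i, v⟫ = 0})) := by
    ext v
    simp [signCone]
  rw [this]
  refine isClosed_iInter fun i => ?_
  have hc : Continuous fun v : V => ⟪e i, v⟫ := by fun_prop
  refine IsClosed.inter ?_ (IsClosed.inter ?_ ?_)
  · by_cases h : 0 < ⟪e i, x⟫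
    · simpa [h] using isClosed_le continuous_const hc
    · simp [h]
  · by_cases h : ⟪e i, x⟫ < 0
    · simpa [h] using isClosed_le hc continuous_const
    · simp [h]
  · by_cases h : ⟪e i, x⟫ = 0
    · simpa [h] using isClosed_eq hc continuous_const
    · simp [h]

lemma convex_signCone (e : ι → V) (x : V) : Convex ℝ (signCone e x) := by
  intro v hv w hw a b ha hb _ i
  obtain ⟨h1, h2, h3⟩ := hv i
  obtain ⟨k1, k2, k3⟩ := hw i
  simp only [inner_add_right, inner_smul_right]
  refine ⟨fun h => ?_, fun h => ?_, fun h => ?_⟩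
  · have := h1 h
    have := k1 h
    positivity
  · have := mul_nonpos_of_nonneg_of_nonpos ha (h2 h)
    have := mul_nonpos_of_nonneg_of_nonpos hb (k2 h)
    linarith
  · rw [h3 h, k3 h]
    simp

/-- A small perturbation of `x` does not change the nonzero signs. -/
lemma exists_small_perturbation (e : ι → V) (x w : V) : ∃ s : ℝ, 0 < s ∧ ∀ i,
    (0 < ⟪e i, x⟫ → 0 < ⟪e i, x + s • w⟫) ∧ (⟪e i, x⟫ < 0 → ⟪e i, x + s • w⟫ < 0) ∧
    (⟪e i, x⟫ = 0 → ⟪e i, x + s • w⟫ = s * ⟪e i, w⟫) := by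
  have hc : ∀ i, Filter.Tendsto (fun s : ℝ => ⟪e i, x + s • w⟫) (nhdsWithin 0 (Set.Ioi 0))
      (nhds ⟪e i, x⟫) := by
    intro i
    have h : Continuous fun s : ℝ => ⟪e i, x + s • w⟫ := by fun_prop
    have := h.tendsto 0
    rw [zero_smul, add_zero] at this
    exact this.mono_left nhdsWithin_le_nhds
  have hev : ∀ᶠ s : ℝ in nhdsWithin 0 (Set.Ioi 0), ∀ i,
      (0 < ⟪e i, x⟫ → 0 < ⟪e i, x + s • w⟫) ∧ (⟪e i, x⟫ < 0 → ⟪e i, x + s • w⟫ < 0) := by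
    refine Filter.eventually_all.2 fun i => Filter.Eventually.and ?_ ?_
    · by_cases h : 0 < ⟪e i, x⟫
      · filter_upwards [(hc i).eventually_const_lt h] with s hs _ using hs
      · exact Filter.Eventually.of_forall fun s h' => absurd h' h
    · by_cases h : ⟪e i, x⟫ < 0
      · filter_upwards [(hc i).eventually_lt_const h] with s hs _ using hs
      · exact Filter.Eventually.of_forall fun s h' => absurd h' h
  obtain ⟨s, hs, hs0⟩ := (hev.and self_mem_nhdsWithin).exists
  refine ⟨s, hs0, fun i => ⟨(hs i).1, (hs i).2, fun h => ?_⟩⟩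
  rw [inner_add_right, inner_smul_right, h, zero_add]

/-- In the complement, the connected component of `x` consists of the vectors with the same
signs as `x`. -/
lemma connectedComponentIn_arrComplement {e : ι → V} {x : V} (hx : x ∈ arrComplement e) :
    connectedComponentIn (arrComplement e) x = {v | ∀ i, 0 < ⟪e i, x⟫ * ⟪e i, v⟫} := by
  apply Set.Subset.antisymm
  · intro v hv i
    by_contra! hneg
    have hpre : IsPreconnected (connectedComponentIn (arrComplement e) x) :=
      isPreconnected_connectedComponentIn
    have himg := hpre.image (fun v => ⟪e i, x⟫ * ⟪e i, v⟫) (by fun_prop)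
    have h0 : (0 : ℝ) ∈ (fun v => ⟪e i, x⟫ * ⟪e i, v⟫) ''
        connectedComponentIn (arrComplement e) x :=
      himg.ordConnected.out ⟨v, hv, rfl⟩ ⟨x, mem_connectedComponentIn hx, rfl⟩
        ⟨hneg, mul_self_nonneg _⟩
    obtain ⟨w, hw, hw0⟩ := h0
    have hwc := connectedComponentIn_subset _ _ hw
    exact mul_ne_zero (hx i) (hwc i) hw0
  · refine IsPreconnected.subset_connectedComponentIn (Convex.isPreconnected ?_) ?_ ?_
    · intro v hv w hw a b ha hb hab i
      have h1 := hv i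
      have h2 := hw i
      rw [inner_add_right, inner_smul_right, inner_smul_right]
      have : ⟪e i, x⟫ * (a * ⟪e i, v⟫ + b * ⟪e i, w⟫) =
        a * (⟪e i, x⟫ * ⟪e i, v⟫) + b * (⟪e i, x⟫ * ⟪e i, w⟫) := by ring
      rw [this]
      rcases ha.lt_or_eq with h | h
      · have := mul_pos h h1
        have := mul_nonneg hb h2.le
        linarith
      · subst h
        have : b = 1 := by linarith
        subst this
        linarith
    · exact fun i => mul_self_pos.2 (hx i)
    · intro v hv i h
      have := hv i
      rw [h, mul_zero] at this
      exact lt_irrefl _ this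

lemma closure_connectedComponentIn_arrComplement {e : ι → V} {x : V}
    (hx : x ∈ arrComplement e) :
    closure (connectedComponentIn (arrComplement e) x) = signCone e x := by
  rw [connectedComponentIn_arrComplement hx]
  apply Set.Subset.antisymm
  · refine closure_minimal (fun v hv i => ?_) (isClosed_signCone e x)
    have h := hv i
    refine ⟨fun h' => (pos_of_mul_pos_right h h'.le).le, fun h' => ?_,
      fun h' => absurd h' (hx i)⟩
    by_contra! h''
    exact absurd h (not_lt.2 (mul_neg_of_neg_of_pos h' h'').le)
  · intro v hv
    have hlim : Filter.Tendsto (fun s : ℝ => v + s • x) (nhdsWithin 0 (Set.Ioi 0)) (nhds v) := by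
      have h : Continuous fun s : ℝ => v + s • x := by fun_prop
      have := h.tendsto 0
      rw [zero_smul, add_zero] at this
      exact this.mono_left nhdsWithin_le_nhds
    refine mem_closure_of_tendsto hlim ?_
    filter_upwards [self_mem_nhdsWithin] with s hs i
    have hs : 0 < s := hs
    rw [inner_add_right, inner_smul_right, mul_add]
    have h1 : 0 ≤ ⟪e i, x⟫ * ⟪e i, v⟫ := by
      rcases lt_or_gt_of_ne (hx i) with h | h
      · exact mul_nonneg_of_nonpos_of_nonpos h.le ((hv i).2.1 h)
      · exact mul_nonneg h.le ((hv i).1 h)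
    have h2 : 0 < s * (⟪e i, x⟫ * ⟪e i, x⟫) := mul_pos hs (mul_self_pos.2 (hx i))
    nlinarith

lemma isRegion_iff {e : ι → V} {R : Set V} :
    IsRegion e R ↔ ∃ x ∈ arrComplement e, R = signCone e x := by
  constructor
  · rintro ⟨x, hx, rfl⟩
    exact ⟨x, hx, closure_connectedComponentIn_arrComplement hx⟩
  · rintro ⟨x, hx, rfl⟩
    exact ⟨x, hx, (closure_connectedComponentIn_arrComplement hx).symm⟩

lemma IsFace.exists_eq_signCone {e : ι → V} {F : Set V} (hF : IsFace e F) :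
    ∃ x, F = signCone e x := by
  classical
  obtain ⟨Rs, ⟨R₀, hR₀⟩, hR, rfl⟩ := hF
  have h0 : (0 : V) ∈ ⋂₀ Rs := by
    intro R hRs
    obtain ⟨y, -, rfl⟩ := isRegion_iff.1 (hR R hRs)
    intro i
    simp
  have hch : ∀ i, ∃ v ∈ ⋂₀ Rs, (∃ w ∈ ⋂₀ Rs, ⟪e i, w⟫ ≠ 0) → ⟪e i, v⟫ ≠ 0 := by
    intro i
    by_cases h : ∃ w ∈ ⋂₀ Rs, ⟪e i, w⟫ ≠ 0
    · obtain ⟨w, hw, hw0⟩ := h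
      exact ⟨w, hw, fun _ => hw0⟩
    · exact ⟨0, h0, fun h' => absurd h' h⟩
  choose f hf hf0 using hch
  obtain ⟨y₀, hy₀, hR₀y⟩ := isRegion_iff.1 (hR R₀ hR₀)
  have hsign : ∀ v ∈ ⋂₀ Rs, ∀ i, 0 ≤ ⟪e i, y₀⟫ * ⟪e i, v⟫ := by
    intro v hv i
    have hv' : v ∈ signCone e y₀ := hR₀y ▸ hv R₀ hR₀
    rcases lt_or_gt_of_ne (hy₀ i) with h | h
    · exact mul_nonneg_of_nonpos_of_nonpos h.le ((hv' i).2.1 h)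
    · exact mul_nonneg h.le ((hv' i).1 h)
  have hxsum : ∀ i, ⟪e i, ∑ j, f j⟫ = ∑ j, ⟪e i, f j⟫ := fun i => inner_sum _ _ _
  have hx : ∑ j, f j ∈ ⋂₀ Rs := by
    intro R hRs
    obtain ⟨y, -, rfl⟩ := isRegion_iff.1 (hR R hRs)
    intro i
    rw [hxsum]
    exact ⟨fun h => Finset.sum_nonneg fun j _ => (hf j _ hRs i).1 h,
      fun h => Finset.sum_nonpos fun j _ => (hf j _ hRs i).2.1 h,
      fun h => Finset.sum_eq_zero fun j _ => (hf j _ hRs i).2.2 h⟩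
  have hzero : ∀ i, ⟪e i, ∑ j, f j⟫ = 0 → ∀ v ∈ ⋂₀ Rs, ⟪e i, v⟫ = 0 := by
    intro i hi v hv
    by_contra hv0
    have h1 : ∑ j, ⟪e i, y₀⟫ * ⟪e i, f j⟫ = 0 := by
      rw [← Finset.mul_sum, ← hxsum, hi, mul_zero]
    have h2 := (Finset.sum_eq_zero_iff_of_nonneg fun j _ => hsign _ (hf j) i).1 h1 i
      (Finset.mem_univ i)
    exact mul_ne_zero (hy₀ i) (hf0 i ⟨v, hv, hv0⟩) h2
  refine ⟨∑ j, f j, Set.Subset.antisymm (fun v hv i => ?_) (fun v hv R hRs => ?_)⟩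
  · have hvs := hsign v hv i
    have hxs := hsign _ hx i
    refine ⟨fun h => ?_, fun h => ?_, fun h => hzero i h v hv⟩
    · have : 0 < ⟪e i, y₀⟫ := lt_of_le_of_ne (nonneg_of_mul_nonneg_left hxs h) (hy₀ i).symm
      exact nonneg_of_mul_nonneg_right hvs this
    · have : ⟪e i, y₀⟫ < 0 := by
        refine lt_of_le_of_ne ?_ (hy₀ i)
        by_contra! h'
        exact absurd hxs (not_le.2 (mul_neg_of_pos_of_neg h' h))
      by_contra! h'
      exact absurd hvs (not_le.2 (mul_neg_of_neg_of_pos this h'))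
  · obtain ⟨y, -, rfl⟩ := isRegion_iff.1 (hR R hRs)
    exact signCone_subset_of_mem (hx _ hRs) hv

lemma isFace_signCone {e : ι → V} {b : V} (hb : ∀ i, 0 < ⟪e i, b⟫) (x : V) :
    IsFace e (signCone e x) := by
  have hpert : ∀ w : V, (∀ i, ⟪e i, w⟫ ≠ 0) → ∃ y ∈ arrComplement e, x ∈ signCone e y ∧
      (∀ i, ⟪e i, x⟫ = 0 → 0 < ⟪e i, w⟫ * ⟪e i, y⟫) := by
    intro w hw
    obtain ⟨s, hs, h⟩ := exists_small_perturbation e x w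
    refine ⟨x + s • w, fun i => ?_, fun i => ?_, fun i hi => ?_⟩
    · obtain ⟨h1, h2, h3⟩ := h i
      rcases lt_trichotomy ⟪e i, x⟫ 0 with h | h | h
      · exact (h2 h).ne
      · rw [h3 h]
        exact mul_ne_zero hs.ne' (hw i)
      · exact (h1 h).ne'
    · obtain ⟨h1, h2, h3⟩ := h i
      rcases lt_trichotomy ⟪e i, x⟫ 0 with h | h | h
      · have := h2 h
        exact ⟨fun h' => by linarith, fun _ => h.le, fun h' => by linarith⟩
      · exact ⟨fun _ => h.ge, fun _ => h.le, fun _ => h⟩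
      · have := h1 h
        exact ⟨fun _ => h.le, fun h' => by linarith, fun h' => by linarith⟩
    · rw [(h i).2.2 hi, mul_left_comm]
      exact mul_pos hs (mul_self_pos.2 (hw i))
  obtain ⟨y, hy, hxy, hyb⟩ := hpert b fun i => (hb i).ne'
  obtain ⟨z, hz, hxz, hzb⟩ := hpert (-b) fun i => by
    rw [inner_neg_right]
    exact neg_ne_zero.2 (hb i).ne'
  refine ⟨{R | IsRegion e R ∧ x ∈ R}, ⟨signCone e y, isRegion_iff.2 ⟨y, hy, rfl⟩, hxy⟩,
    fun R hR => hR.1, Set.Subset.antisymm ?_ ?_⟩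
  · rintro v hv R ⟨hR, hxR⟩
    obtain ⟨w, -, rfl⟩ := isRegion_iff.1 hR
    exact signCone_subset_of_mem hxR hv
  · intro v hv i
    have h1 := hv _ ⟨isRegion_iff.2 ⟨y, hy, rfl⟩, hxy⟩ i
    have h2 := hv _ ⟨isRegion_iff.2 ⟨z, hz, rfl⟩, hxz⟩ i
    refine ⟨fun h => h1.1 ?_, fun h => h1.2.1 ?_, fun h => ?_⟩
    · by_contra! h'
      have := (hxy i).2.1 (lt_of_le_of_ne h' (hy i))
      linarith
    · by_contra! h'
      have := (hxy i).1 (lt_of_le_of_ne h' (hy i).symm)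
      linarith
    · have hyp : 0 < ⟪e i, y⟫ := pos_of_mul_pos_right (hyb i h) (hb i).le
      have hzn : ⟪e i, z⟫ < 0 := by
        have := hzb i h
        rw [inner_neg_right] at this
        nlinarith [hb i]
      exact le_antisymm (h2.2.1 hzn) (h1.1 hyp)

lemma covec_signCone (e : ι → V) (x : V) (i : ι) :
    covec e (signCone e x) i = SignType.sign ⟪e i, x⟫ := by
  have hne : (intrinsicInterior ℝ (signCone e x)).Nonempty :=
    Set.Nonempty.intrinsicInterior (convex_signCone e x) ⟨x, self_mem_signCone e x⟩
  obtain ⟨w, hw⟩ := hne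
  have hback : ∀ v ∈ intrinsicInterior ℝ (signCone e x),
      ∃ t : ℝ, 0 < t ∧ v + t • (v - x) ∈ signCone e x := by
    intro v hv
    obtain ⟨y, hy, rfl⟩ := mem_intrinsicInterior.1 hv
    have hmem : ∀ t : ℝ, (y : V) + t • ((y : V) - x) ∈ affineSpan ℝ (signCone e x) := by
      intro t
      have := AffineMap.lineMap_mem (k := ℝ) (-t) y.2
        (subset_affineSpan ℝ _ (self_mem_signCone e x))
      rw [AffineMap.lineMap_apply_module'] at this
      convert this using 1
      module
    have hc : Continuous fun t : ℝ =>
        (⟨(y : V) + t • ((y : V) - x), hmem t⟩ : affineSpan ℝ (signCone e x)) := by fun_prop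
    have h0 : (⟨(y : V) + (0 : ℝ) • ((y : V) - x), hmem 0⟩ : affineSpan ℝ (signCone e x)) = y := by
      ext
      simp
    have hev : ∀ᶠ t : ℝ in nhds 0,
        (⟨(y : V) + t • ((y : V) - x), hmem t⟩ : affineSpan ℝ (signCone e x)) ∈
          interior ((↑) ⁻¹' signCone e x : Set (affineSpan ℝ (signCone e x))) := by
      refine hc.continuousAt.eventually_mem ?_
      rw [h0]
      exact isOpen_interior.mem_nhds hy
    obtain ⟨t, ht, ht0⟩ :=
      ((hev.filter_mono nhdsWithin_le_nhds).and
        (self_mem_nhdsWithin (a := (0 : ℝ)) (s := Set.Ioi 0))).exists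
    exact ⟨t, ht0, interior_subset (s := Subtype.val ⁻¹' signCone e x) ht⟩
  have hpos : 0 < ⟪e i, x⟫ → ∀ v ∈ intrinsicInterior ℝ (signCone e x), 0 < ⟪e i, v⟫ := by
    intro h v hv
    obtain ⟨t, ht, hm⟩ := hback v hv
    have := (hm i).1 h
    rw [inner_add_right, inner_smul_right, inner_sub_right] at this
    nlinarith [mul_pos ht h]
  have hneg : ⟪e i, x⟫ < 0 → ∀ v ∈ intrinsicInterior ℝ (signCone e x), ⟪e i, v⟫ < 0 := by
    intro h v hv
    obtain ⟨t, ht, hm⟩ := hback v hv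
    have := (hm i).2.1 h
    rw [inner_add_right, inner_smul_right, inner_sub_right] at this
    nlinarith [mul_neg_of_pos_of_neg ht h]
  unfold covec
  rcases lt_trichotomy ⟪e i, x⟫ 0 with h | h | h
  · rw [if_neg fun h' => lt_asymm (h' w hw) (hneg h w hw), if_pos (hneg h), sign_neg h]
  · have hw0 : ⟪e i, w⟫ = 0 := (intrinsicInterior_subset hw i).2.2 h
    rw [if_neg fun h' => (h' w hw).ne' hw0, if_neg fun h' => (h' w hw).ne hw0, h, sign_zero]
  · rw [if_pos (hpos h), sign_pos h]

lemma sign_le_sign_iff {a c : ℝ} :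
    SignType.sign a ≤ SignType.sign c ↔ (c < 0 → a < 0) ∧ (c ≤ 0 → a ≤ 0) := by
  rcases lt_trichotomy a 0 with h | rfl | h <;> rcases lt_trichotomy c 0 with h' | rfl | h' <;>
    simp [*, le_of_lt, not_lt_of_gt, not_le_of_gt]

lemma sepSet_signCone {e : ι → V} {b y : V} (hb : ∀ i, 0 < ⟪e i, b⟫)
    (hy : y ∈ arrComplement e) :
    sepSet e (signCone e b) (signCone e y) = {i | ⟪e i, y⟫ < 0} := by
  ext i
  constructor
  · rintro (⟨-, h⟩ | ⟨h, -⟩)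
    · exact lt_of_le_of_ne (h (self_mem_signCone e y)) (hy i)
    · exact absurd (h (self_mem_signCone e b)) (not_le.2 (hb i))
  · intro h
    exact Or.inl ⟨fun v hv => (hv i).1 (hb i), fun v hv => (hv i).2.1 h⟩

lemma signCone_subset_region_iff {e : ι → V} {x y : V} (hy : y ∈ arrComplement e) :
    signCone e x ⊆ signCone e y ↔
      {i | ⟪e i, x⟫ < 0} ⊆ {i | ⟪e i, y⟫ < 0} ∧ {i | ⟪e i, y⟫ < 0} ⊆ {i | ⟪e i, x⟫ ≤ 0} := by
  rw [signCone_subset_iff]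
  constructor
  · intro h
    refine ⟨fun i hi => ?_, fun i hi => (h i).2.1 hi⟩
    by_contra h'
    have := (h i).1 (lt_of_le_of_ne (not_lt.1 h') (hy i).symm)
    exact absurd hi (not_lt.2 this)
  · rintro ⟨h1, h2⟩ i
    refine ⟨fun h => ?_, fun h => h2 h, fun h => absurd h (hy i)⟩
    by_contra! h'
    exact lt_asymm h (h1 h')

lemma exists_facial_regions {e : ι → V} {b : V} (hb : ∀ i, 0 < ⟪e i, b⟫) (x : V) :
    ∃ m M, IsRegion e m ∧ IsRegion e M ∧ sepSet e (signCone e b) m = {i | ⟪e i, x⟫ < 0} ∧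
      sepSet e (signCone e b) M = {i | ⟪e i, x⟫ ≤ 0} := by
  obtain ⟨s, hs, h⟩ := exists_small_perturbation e x b
  obtain ⟨t, ht, k⟩ := exists_small_perturbation e x (-b)
  have hsb : ∀ i, 0 < s * ⟪e i, b⟫ := fun i => mul_pos hs (hb i)
  have htb : ∀ i, t * ⟪e i, -b⟫ < 0 := fun i => by
    rw [inner_neg_right]
    exact mul_neg_of_pos_of_neg ht (neg_neg_of_pos (hb i))
  have hm : x + s • b ∈ arrComplement e := fun i => by
    obtain ⟨h1, h2, h3⟩ := h i
    rcases lt_trichotomy ⟪e i, x⟫ 0 with h | h | h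
    · exact (h2 h).ne
    · exact h3 h ▸ (hsb i).ne'
    · exact (h1 h).ne'
  have hM : x + t • -b ∈ arrComplement e := fun i => by
    obtain ⟨h1, h2, h3⟩ := k i
    rcases lt_trichotomy ⟪e i, x⟫ 0 with h | h | h
    · exact (h2 h).ne
    · exact h3 h ▸ (htb i).ne
    · exact (h1 h).ne'
  refine ⟨signCone e (x + s • b), signCone e (x + t • -b), isRegion_iff.2 ⟨_, hm, rfl⟩,
    isRegion_iff.2 ⟨_, hM, rfl⟩, ?_, ?_⟩
  · rw [sepSet_signCone hb hm]
    ext i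
    obtain ⟨h1, h2, h3⟩ := h i
    refine ⟨fun h' => ?_, h2⟩
    rcases lt_trichotomy ⟪e i, x⟫ 0 with h | h | h
    · exact h
    · have h' : ⟪e i, x + s • b⟫ < 0 := h'
      rw [h3 h] at h'
      exact absurd h' (hsb i).not_gt
    · exact absurd h' (h1 h).not_gt
  · rw [sepSet_signCone hb hM]
    ext i
    obtain ⟨h1, h2, h3⟩ := k i
    refine ⟨fun h' => ?_, fun h' => ?_⟩
    · by_contra h
      exact absurd h' (h1 (not_le.1 h)).not_gt
    · rcases lt_or_eq_of_le (show ⟪e i, x⟫ ≤ 0 from h') with h | h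
      · exact h2 h
      · exact (h3 h).trans_lt (htb i)

lemma isFacialInterval_signCone_iff {e : ι → V} {b : V} (hb : ∀ i, 0 < ⟪e i, b⟫) {x : V}
    {m M : Set V} :
    IsFacialInterval e (signCone e b) (signCone e x) m M ↔
      IsRegion e m ∧ IsRegion e M ∧ sepSet e (signCone e b) m = {i | ⟪e i, x⟫ < 0} ∧
        sepSet e (signCone e b) M = {i | ⟪e i, x⟫ ≤ 0} := by
  have key : ∀ R, IsRegion e R → (signCone e x ⊆ R ↔
      {i | ⟪e i, x⟫ < 0} ⊆ sepSet e (signCone e b) R ∧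
        sepSet e (signCone e b) R ⊆ {i | ⟪e i, x⟫ ≤ 0}) := by
    intro R hR
    obtain ⟨y, hy, rfl⟩ := isRegion_iff.1 hR
    rw [signCone_subset_region_iff hy, sepSet_signCone hb hy]
  constructor
  · rintro ⟨hm, hM, h⟩
    obtain ⟨m', M', hm', hM', hms, hMs⟩ := exists_facial_regions hb x
    have hle : {i | ⟪e i, x⟫ < 0} ⊆ {i | ⟪e i, x⟫ ≤ 0} := fun i hi => le_of_lt (Set.mem_ofPred.1 hi)
    have h1 := (h m' hm').1 ((key m' hm').2 (by rw [hms]; exact ⟨le_rfl, hle⟩))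
    have h2 := (h M' hM').1 ((key M' hM').2 (by rw [hMs]; exact ⟨hle, le_rfl⟩))
    have hmM : PRle e (signCone e b) m M := Set.Subset.trans h1.1 h1.2
    have h3 := (key m hm).1 ((h m hm).2 ⟨Set.Subset.rfl, hmM⟩)
    have h4 := (key M hM).1 ((h M hM).2 ⟨hmM, Set.Subset.rfl⟩)
    exact ⟨hm, hM, Set.Subset.antisymm (hms ▸ h1.1) h3.1,
      Set.Subset.antisymm h4.2 (hMs ▸ h2.2)⟩
  · rintro ⟨hm, hM, hms, hMs⟩
    refine ⟨hm, hM, fun R hR => ?_⟩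
    rw [key R hR, PRle, PRle, hms, hMs]

lemma fwle_signCone_iff {e : ι → V} {b : V} (hb : ∀ i, 0 < ⟪e i, b⟫) {x y : V} :
    FWle e (signCone e b) (signCone e x) (signCone e y) ↔
      ∀ i, SignType.sign ⟪e i, y⟫ ≤ SignType.sign ⟪e i, x⟫ := by
  simp only [sign_le_sign_iff, FWle, isFacialInterval_signCone_iff hb, PRle]
  constructor
  · rintro ⟨mF, MF, mG, MG, ⟨-, -, h1, h2⟩, ⟨-, -, h3, h4⟩, h5, h6⟩ i
    rw [h1, h3] at h5
    rw [h2, h4] at h6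
    exact ⟨fun h => h5 h, fun h => h6 h⟩
  · intro h
    obtain ⟨mF, MF, hmF, hMF, h1, h2⟩ := exists_facial_regions hb x
    obtain ⟨mG, MG, hmG, hMG, h3, h4⟩ := exists_facial_regions hb y
    refine ⟨mF, MF, mG, MG, ⟨hmF, hMF, h1, h2⟩, ⟨hmG, hMG, h3, h4⟩, ?_, ?_⟩
    · rw [h1, h3]
      exact fun i => (h i).1
    · rw [h2, h4]
      exact fun i => (h i).2

lemma sameMax_signCone_iff {e : ι → V} {b : V} (hb : ∀ i, 0 < ⟪e i, b⟫) {x y : V} :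
    SameMax e (signCone e b) (signCone e x) (signCone e y) ↔
      ∀ i, ⟪e i, x⟫ ≤ 0 ↔ ⟪e i, y⟫ ≤ 0 := by
  simp only [SameMax, isFacialInterval_signCone_iff hb]
  constructor
  · rintro ⟨m, m', M, ⟨-, -, -, h1⟩, -, -, -, h2⟩
    exact fun i => Set.ext_iff.1 (h1.symm.trans h2) i
  · intro h
    obtain ⟨m, M, hm, hM, h1, h2⟩ := exists_facial_regions hb x
    obtain ⟨m', -, hm', -, h3, -⟩ := exists_facial_regions hb y
    exact ⟨m, m', M, ⟨hm, hM, h1, h2⟩, hm', hM, h3, h2.trans (Set.ext h)⟩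

lemma sameMin_signCone_iff {e : ι → V} {b : V} (hb : ∀ i, 0 < ⟪e i, b⟫) {x y : V} :
    SameMin e (signCone e b) (signCone e x) (signCone e y) ↔
      ∀ i, ⟪e i, x⟫ < 0 ↔ ⟪e i, y⟫ < 0 := by
  simp only [SameMin, isFacialInterval_signCone_iff hb]
  constructor
  · rintro ⟨m, M, M', ⟨-, -, h1, -⟩, -, -, h2, -⟩
    exact fun i => Set.ext_iff.1 (h1.symm.trans h2) i
  · intro h
    obtain ⟨m, M, hm, hM, h1, h2⟩ := exists_facial_regions hb x
    obtain ⟨-, M', -, hM', -, h3⟩ := exists_facial_regions hb y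
    exact ⟨m, M, M', ⟨hm, hM, h1, h2⟩, hm, hM', h1.trans (Set.ext h), h3⟩

lemma fdim_signCone (e : ι → V) (x : V) :
    fdim (signCone e x) = Module.finrank ℝ (flatSpan e x) := by
  have : Submodule.span ℝ (signCone e x) = flatSpan e x := by
    apply le_antisymm
    · exact Submodule.span_le.2 fun v hv i => (hv i).2.2
    · intro v hv
      obtain ⟨s, hs, h⟩ := exists_small_perturbation e x v
      have hmem : x + s • v ∈ signCone e x := fun i =>
        ⟨fun h' => ((h i).1 h').le, fun h' => ((h i).2.1 h').le, fun h' => by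
          rw [(h i).2.2 h', hv i h', mul_zero]⟩
      have hv' : v = s⁻¹ • ((x + s • v) - x) := by
        rw [add_sub_cancel_left, smul_smul, inv_mul_cancel₀ hs.ne', one_smul]
      rw [hv']
      exact Submodule.smul_mem _ _ (Submodule.sub_mem _ (Submodule.subset_span hmem)
        (Submodule.subset_span (self_mem_signCone e x)))
  rw [fdim, this]

lemma flatSpan_mono {e : ι → V} {x y : V} (h : x ∈ signCone e y) :
    flatSpan e x ≤ flatSpan e y := fun _ hv i hi => hv i ((h i).2.2 hi)

lemma signCone_eq_of_finrank_le {e : ι → V} {x y : V} (h : x ∈ signCone e y)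
    (hd : Module.finrank ℝ (flatSpan e y) ≤ Module.finrank ℝ (flatSpan e x)) :
    signCone e x = signCone e y := by
  have heq := Submodule.eq_of_le_of_finrank_le (flatSpan_mono h) hd
  have hy : y ∈ flatSpan e x := heq ▸ fun _ => id
  refine Set.Subset.antisymm (signCone_subset_of_mem h) (signCone_subset_of_mem fun i => ?_)
  obtain ⟨h1, h2, -⟩ := h i
  refine ⟨fun hx => ?_, fun hx => ?_, hy i⟩
  · by_contra! h'
    linarith [h2 h']
  · by_contra! h'
    linarith [h1 h']

/-- Two nested faces whose dimensions differ by at least two have a face strictly between them. -/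
lemma exists_intermediate {e : ι → V} {x y : V} (h : x ∈ signCone e y)
    (hd : Module.finrank ℝ (flatSpan e x) + 1 < Module.finrank ℝ (flatSpan e y)) :
    ∃ z, x ∈ signCone e z ∧ z ∈ signCone e y ∧ flatSpan e x < flatSpan e z ∧
      flatSpan e z < flatSpan e y := by
  classical
  obtain ⟨u, huy, hu⟩ : ∃ u ∈ flatSpan e y, u ∉ flatSpan e x ⊔ Submodule.span ℝ {y} := by
    by_contra! hcon
    have h1 := Submodule.finrank_mono (show flatSpan e y ≤ _ from hcon)
    have h2 := Submodule.finrank_add_le_finrank_add_finrank (flatSpan e x)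
      (Submodule.span ℝ {y})
    have h3 : Module.finrank ℝ (Submodule.span ℝ {y}) ≤ 1 := by
      simpa using finrank_span_le_card (R := ℝ) ({y} : Set V)
    omega
  obtain ⟨j, hjx, hju⟩ : ∃ j, ⟪e j, x⟫ = 0 ∧ ⟪e j, u⟫ ≠ 0 := by
    by_contra! hcon
    exact hu (Submodule.mem_sup_left fun i hi => hcon i hi)
  wlog hsgn : ⟪e j, u⟫ * ⟪e j, y⟫ < 0 generalizing u
  · refine this (-u) (Submodule.neg_mem _ huy) (fun h' => hu ?_) ?_ ?_
    · simpa using Submodule.neg_mem _ h'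
    · rw [inner_neg_right]
      exact neg_ne_zero.2 hju
    · rw [inner_neg_right]
      have hjy : ⟪e j, y⟫ ≠ 0 := fun h' => hju (huy j h')
      have := lt_of_le_of_ne (not_lt.1 hsgn) (mul_ne_zero hju hjy).symm
      linarith
  obtain ⟨k, hk, hmin⟩ := Finset.exists_min_image
    (Finset.univ.filter fun i => ⟪e i, x⟫ = 0 ∧ ⟪e i, u⟫ * ⟪e i, y⟫ < 0)
    (fun i => -⟪e i, y⟫ / ⟪e i, u⟫) ⟨j, by simp [hjx, hsgn]⟩
  simp only [Finset.mem_filter, Finset.mem_univ, true_and] at hk hmin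
  obtain ⟨hkx, hks⟩ := hk
  have hku : ⟪e k, u⟫ ≠ 0 := fun h' => by rw [h', zero_mul] at hks; exact lt_irrefl _ hks
  have hky : ⟪e k, y⟫ ≠ 0 := fun h' => by rw [h', mul_zero] at hks; exact lt_irrefl _ hks
  set t : ℝ := -⟪e k, y⟫ / ⟪e k, u⟫ with ht
  have htpos : 0 < t := by
    have : t = -(⟪e k, u⟫ * ⟪e k, y⟫) / (⟪e k, u⟫ * ⟪e k, u⟫) := by
      rw [ht]
      field_simp
    rw [this]
    exact div_pos (by linarith) (mul_self_pos.2 hku)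
  have hw : ∀ i, ⟪e i, y + t • u⟫ = ⟪e i, y⟫ + t * ⟪e i, u⟫ := fun i => by
    rw [inner_add_right, inner_smul_right]
  have hwk : ⟪e k, y + t • u⟫ = 0 := by
    rw [hw, ht]
    field_simp
    ring
  have hwpos : ∀ i, ⟪e i, x⟫ = 0 → 0 < ⟪e i, y⟫ → 0 ≤ ⟪e i, y + t • u⟫ := by
    intro i hi hy
    rw [hw]
    rcases le_or_gt 0 ⟪e i, u⟫ with hui | hui
    · positivity
    · have := hmin i ⟨hi, mul_neg_of_neg_of_pos hui hy⟩
      rw [le_div_iff_of_neg hui] at this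
      linarith
  have hwneg : ∀ i, ⟪e i, x⟫ = 0 → ⟪e i, y⟫ < 0 → ⟪e i, y + t • u⟫ ≤ 0 := by
    intro i hi hy
    rw [hw]
    rcases le_or_gt ⟪e i, u⟫ 0 with hui | hui
    · linarith [mul_nonpos_of_nonneg_of_nonpos htpos.le hui]
    · have := hmin i ⟨hi, mul_neg_of_pos_of_neg hui hy⟩
      rw [le_div_iff₀ hui] at this
      linarith
  obtain ⟨s, hs, hz⟩ := exists_small_perturbation e x (y + t • u)
  have hxz : x ∈ signCone e (x + s • (y + t • u)) := by
    intro i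
    obtain ⟨z1, z2, z3⟩ := hz i
    rcases lt_trichotomy ⟪e i, x⟫ 0 with h' | h' | h'
    · have := z2 h'
      exact ⟨fun _ => by linarith, fun _ => h'.le, fun _ => by linarith⟩
    · exact ⟨fun _ => h'.ge, fun _ => h'.le, fun _ => h'⟩
    · have := z1 h'
      exact ⟨fun _ => h'.le, fun _ => by linarith, fun _ => by linarith⟩
  have hzy : x + s • (y + t • u) ∈ signCone e y := by
    intro i
    obtain ⟨z1, z2, z3⟩ := hz i
    obtain ⟨h1, h2, h3⟩ := h i
    refine ⟨fun hy => ?_, fun hy => ?_, fun hy => ?_⟩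
    · rcases (h1 hy).lt_or_eq with h' | h'
      · exact (z1 h').le
      · rw [z3 h'.symm]
        exact mul_nonneg hs.le (hwpos i h'.symm hy)
    · rcases (h2 hy).lt_or_eq with h' | h'
      · exact (z2 h').le
      · rw [z3 h']
        exact mul_nonpos_of_nonneg_of_nonpos hs.le (hwneg i h' hy)
    · rw [z3 (h3 hy), hw, hy, huy i hy]
      simp
  refine ⟨_, hxz, hzy, lt_of_le_of_ne (flatSpan_mono hxz) fun heq => hu ?_,
    lt_of_le_of_ne (flatSpan_mono hzy) fun heq => hky ?_⟩
  · have hmem : x + s • (y + t • u) ∈ flatSpan e x := heq ▸ fun _ => id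
    have hw' : y + t • u ∈ flatSpan e x := by
      intro i hi
      have := hmem i hi
      rw [(hz i).2.2 hi] at this
      exact (mul_eq_zero.1 this).resolve_left hs.ne'
    have hu' : u = t⁻¹ • (y + t • u) + (-t⁻¹) • y := by
      rw [smul_add, smul_smul, inv_mul_cancel₀ htpos.ne', one_smul]
      module
    rw [hu']
    exact Submodule.add_mem_sup (Submodule.smul_mem _ _ hw')
      (Submodule.smul_mem _ _ (Submodule.mem_span_singleton_self y))
  · have hmem : y ∈ flatSpan e (x + s • (y + t • u)) := heq ▸ fun _ => id
    refine hmem k ?_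
    rw [(hz k).2.2 hkx, hwk, mul_zero]

/-- Nested faces are joined by a saturated chain of faces lying between them. -/
lemma exists_saturated_chain (e : ι → V) {x₀ y₀ : V} (n : ℕ) : ∀ x y : V,
    x₀ ∈ signCone e x → x ∈ signCone e y → y ∈ signCone e y₀ →
    Module.finrank ℝ (flatSpan e y) ≤ Module.finrank ℝ (flatSpan e x) + n →
    Relation.ReflTransGen (fun F G => ∃ p q, F = signCone e p ∧ G = signCone e q ∧
      x₀ ∈ signCone e p ∧ p ∈ signCone e q ∧ q ∈ signCone e y₀ ∧
      Module.finrank ℝ (flatSpan e q) = Module.finrank ℝ (flatSpan e p) + 1)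
      (signCone e x) (signCone e y) := by
  induction n using Nat.strong_induction_on with
  | _ n ih =>
    intro x y hx hxy hy hd
    rcases lt_trichotomy (Module.finrank ℝ (flatSpan e y))
      (Module.finrank ℝ (flatSpan e x) + 1) with h | h | h
    · rw [signCone_eq_of_finrank_le hxy (by omega)]
    · exact Relation.ReflTransGen.single ⟨x, y, rfl, rfl, hx, hxy, hy, h⟩
    · obtain ⟨z, hxz, hzy, h1, h2⟩ := exists_intermediate hxy h
      have d1 := Submodule.finrank_lt_finrank_of_lt h1
      have d2 := Submodule.finrank_lt_finrank_of_lt h2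
      exact (ih (n - 1) (by omega) x z hx hxz (signCone_subset_of_mem hy hzy) (by omega)).trans
        (ih (n - 1) (by omega) z y (signCone_subset_of_mem hxz hx) hzy hy (by omega))

/-- An elementary step in the facial weak order. -/
def FaceStep (e : ι → V) (B F G : Set V) : Prop :=
  (IsFace e F ∧ IsFace e G) ∧ (fdim F = fdim G + 1 ∨ fdim G = fdim F + 1) ∧
    ((F ⊆ G ∧ SameMax e B F G) ∨ (G ⊆ F ∧ SameMin e B F G))

lemma reflTransGen_faceStep_up {e : ι → V} {b : V} (hb : ∀ i, 0 < ⟪e i, b⟫) {x y : V}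
    (h : x ∈ signCone e y) (hmax : ∀ i, ⟪e i, x⟫ ≤ 0 → ⟪e i, y⟫ ≤ 0) :
    Relation.ReflTransGen (FaceStep e (signCone e b)) (signCone e x) (signCone e y) := by
  refine Relation.ReflTransGen.mono ?_ _ _ (exists_saturated_chain e (x₀ := x) (y₀ := y)
    (Module.finrank ℝ (flatSpan e y)) x y (self_mem_signCone e x) h (self_mem_signCone e y)
    (by omega))
  rintro _ _ ⟨p, q, rfl, rfl, hxp, hpq, hqy, hd⟩
  refine ⟨⟨isFace_signCone hb p, isFace_signCone hb q⟩, Or.inr ?_,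
    Or.inl ⟨signCone_subset_of_mem hpq, (sameMax_signCone_iff hb).2 fun i => ?_⟩⟩
  · rw [fdim_signCone, fdim_signCone, hd]
  · constructor
    · intro hp
      by_contra! hq
      have hy : 0 < ⟪e i, y⟫ := by
        by_contra! hy
        rcases hy.lt_or_eq with hy | hy
        · linarith [(hqy i).2.1 hy]
        · linarith [(hqy i).2.2 hy]
      have hx : ⟪e i, x⟫ ≤ 0 := by
        rcases hp.lt_or_eq with hp | hp
        · exact (hxp i).2.1 hp
        · exact ((hxp i).2.2 hp).le
      linarith [hmax i hx]
    · intro hq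
      rcases hq.lt_or_eq with hq | hq
      · exact (hpq i).2.1 hq
      · exact ((hpq i).2.2 hq).le

lemma reflTransGen_faceStep_down {e : ι → V} {b : V} (hb : ∀ i, 0 < ⟪e i, b⟫) {x y : V}
    (h : x ∈ signCone e y) (hmin : ∀ i, ⟪e i, y⟫ < 0 → ⟪e i, x⟫ < 0) :
    Relation.ReflTransGen (FaceStep e (signCone e b)) (signCone e y) (signCone e x) := by
  refine Relation.ReflTransGen.mono ?_ _ _ (exists_saturated_chain e (x₀ := x) (y₀ := y)
    (Module.finrank ℝ (flatSpan e y)) x y (self_mem_signCone e x) h (self_mem_signCone e y)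
    (by omega)).swap
  rintro _ _ ⟨p, q, rfl, rfl, hxp, hpq, hqy, hd⟩
  refine ⟨⟨isFace_signCone hb q, isFace_signCone hb p⟩, Or.inl ?_,
    Or.inr ⟨signCone_subset_of_mem hpq, (sameMin_signCone_iff hb).2 fun i => ?_⟩⟩
  · rw [fdim_signCone, fdim_signCone, hd]
  · constructor
    · intro hq
      have hy : ⟪e i, y⟫ < 0 := by
        by_contra! hy
        rcases hy.lt_or_eq with hy | hy
        · linarith [(hqy i).1 hy]
        · linarith [(hqy i).2.2 hy.symm]
      have hx := hmin i hy
      by_contra! hp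
      rcases hp.lt_or_eq with hp | hp
      · linarith [(hxp i).1 hp]
      · linarith [(hxp i).2.2 hp.symm]
    · intro hp
      by_contra! hq
      rcases hq.lt_or_eq with hq | hq
      · linarith [(hpq i).1 hq]
      · linarith [(hpq i).2.2 hq.symm]

/-- Sign-decreasing pairs are joined by elementary steps, by induction on the number of
hyperplanes strictly separating them. -/
lemma reflTransGen_faceStep_of_sign_le {e : ι → V} {b : V} (hb : ∀ i, 0 < ⟪e i, b⟫) (n : ℕ) :
    ∀ x y : V, (∀ i, SignType.sign ⟪e i, y⟫ ≤ SignType.sign ⟪e i, x⟫) →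
    {i | 0 < ⟪e i, x⟫ ∧ ⟪e i, y⟫ < 0}.ncard = n →
    Relation.ReflTransGen (FaceStep e (signCone e b)) (signCone e x) (signCone e y) := by
  induction n using Nat.strong_induction_on with
  | _ n ih =>
    intro x y hle hn
    have hle' := fun i => sign_le_sign_iff.1 (hle i)
    by_cases hS : ∃ k, 0 < ⟪e k, x⟫ ∧ ⟪e k, y⟫ < 0
    · obtain ⟨k, hkx, hky⟩ := hS
      have hz : ∀ i, ⟪e i, (-⟪e k, y⟫) • x + ⟪e k, x⟫ • y⟫ =
          (-⟪e k, y⟫) * ⟪e i, x⟫ + ⟪e k, x⟫ * ⟪e i, y⟫ := fun i => by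
        rw [inner_add_right, inner_smul_right, inner_smul_right]
      set z := (-⟪e k, y⟫) • x + ⟪e k, x⟫ • y
      have hky' : 0 < -⟪e k, y⟫ := by linarith
      have hzk : ⟪e k, z⟫ = 0 := by
        rw [hz]
        ring
      have hxz : ∀ i, (⟪e i, x⟫ < 0 → ⟪e i, z⟫ < 0) ∧ (⟪e i, x⟫ ≤ 0 → ⟪e i, z⟫ ≤ 0) := by
        intro i
        rw [hz]
        constructor
        · intro h
          linarith [mul_neg_of_pos_of_neg hky' h, mul_neg_of_pos_of_neg hkx ((hle' i).1 h)]
        · intro h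
          linarith [mul_nonpos_of_nonneg_of_nonpos hky'.le h,
            mul_nonpos_of_nonneg_of_nonpos hkx.le ((hle' i).2 h)]
      have hzy : ∀ i, (⟪e i, z⟫ < 0 → ⟪e i, y⟫ < 0) ∧ (⟪e i, z⟫ ≤ 0 → ⟪e i, y⟫ ≤ 0) := by
        intro i
        rw [hz]
        constructor
        · intro h
          by_contra! hy
          have hx : 0 ≤ ⟪e i, x⟫ := by
            by_contra! hx
            linarith [(hle' i).1 hx]
          linarith [mul_nonneg hky'.le hx, mul_nonneg hkx.le hy]
        · intro h
          by_contra! hy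
          have hx : 0 < ⟪e i, x⟫ := by
            by_contra! hx
            linarith [(hle' i).2 hx]
          linarith [mul_pos hky' hx, mul_pos hkx hy]
      have hlt : ∀ T : Set ι, T ⊆ {i | 0 < ⟪e i, x⟫ ∧ ⟪e i, y⟫ < 0} → k ∉ T → T.ncard < n := by
        intro T hT hkT
        rw [← hn]
        exact Set.ncard_lt_ncard (hT.ssubset_of_mem_notMem ⟨hkx, hky⟩ hkT) (Set.toFinite _)
      refine (ih _ (hlt {i | 0 < ⟪e i, x⟫ ∧ ⟪e i, z⟫ < 0} ?_ ?_) x z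
        (fun i => sign_le_sign_iff.2 (hxz i)) rfl).trans
        (ih _ (hlt {i | 0 < ⟪e i, z⟫ ∧ ⟪e i, y⟫ < 0} ?_ ?_) z y
        (fun i => sign_le_sign_iff.2 (hzy i)) rfl)
      · exact fun i hi => ⟨hi.1, (hzy i).1 hi.2⟩
      · exact fun h => h.2.ne hzk
      · refine fun i hi => ⟨?_, hi.2⟩
        by_contra! h
        linarith [(hxz i).2 h, hi.1]
      · exact fun h => h.1.ne' hzk
    · push Not at hS
      have hsum : ∀ i, ⟪e i, x + y⟫ = ⟪e i, x⟫ + ⟪e i, y⟫ := fun i => inner_add_right _ _ _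
      have hxz : x ∈ signCone e (x + y) ∧ y ∈ signCone e (x + y) ∧
          (∀ i, ⟪e i, x⟫ ≤ 0 → ⟪e i, x + y⟫ ≤ 0) ∧ (∀ i, ⟪e i, x + y⟫ < 0 → ⟪e i, y⟫ < 0) := by
        refine ⟨fun i => ?_, fun i => ?_, fun i => ?_, fun i => ?_⟩ <;> rw [hsum] <;>
          have h1 := (hle' i).1 <;> have h2 := (hle' i).2 <;> have h3 := hS i <;>
          grind
      exact (reflTransGen_faceStep_up hb hxz.1 hxz.2.2.1).trans
        (reflTransGen_faceStep_down hb hxz.2.1 hxz.2.2.2)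

lemma covec_le_of_step {e : ι → V} {b : V} (hb : ∀ i, 0 < ⟪e i, b⟫) {F G : Set V}
    (hF : IsFace e F) (hG : IsFace e G)
    (h : (F ⊆ G ∧ SameMax e (signCone e b) F G) ∨ (G ⊆ F ∧ SameMin e (signCone e b) F G)) :
    ∀ i, covec e G i ≤ covec e F i := by
  obtain ⟨x, rfl⟩ := hF.exists_eq_signCone
  obtain ⟨y, rfl⟩ := hG.exists_eq_signCone
  intro i
  rw [covec_signCone, covec_signCone, sign_le_sign_iff]
  rw [signCone_subset_iff, signCone_subset_iff, sameMax_signCone_iff hb,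
    sameMin_signCone_iff hb] at h
  rcases h with ⟨h1, h2⟩ | ⟨h1, h2⟩
  all_goals
    obtain ⟨k1, k2, k3⟩ := h1 i
    have := h2 i
    grind

lemma exists_fin_chain_of_reflTransGen {α : Type*} {r : α → α → Prop} {a c : α}
    (h : Relation.ReflTransGen r a c) :
    ∃ (n : ℕ) (f : Fin (n + 1) → α), f 0 = a ∧ f (Fin.last n) = c ∧
      ∀ k : Fin n, r (f k.castSucc) (f k.succ) := by
  induction h using Relation.ReflTransGen.head_induction_on with
  | refl => exact ⟨0, fun _ => c, rfl, rfl, fun k => k.elim0⟩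
  | @head a _ hab _ ih =>
    obtain ⟨n, f, h0, hl, hf⟩ := ih
    refine ⟨n + 1, Fin.cons a f, Fin.cons_zero _ _, ?_, fun k => ?_⟩
    · rw [← Fin.succ_last, Fin.cons_succ, hl]
    · refine Fin.cases ?_ (fun j => ?_) k
      · simpa [h0] using hab
      · rw [← Fin.succ_castSucc, Fin.cons_succ, Fin.cons_succ]
        exact hf j

/-- Equivalence of: the facial weak order, chains of elementary steps, and the
covector order. -/
theorem stmt8 (e : ι → V) (hne : ∀ i, e i ≠ 0) (B : Set V)
    (hB : IsRegion e B) (hBpos : ∀ i, B ⊆ posHalf e i)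
    (F G : Set V) (hF : IsFace e F) (hG : IsFace e G) :
    (FWle e B F G ↔ (∀ i, covec e G i ≤ covec e F i)) ∧
    (FWle e B F G ↔
      ∃ (n : ℕ) (f : Fin (n + 1) → Set V),
        f 0 = F ∧ f (Fin.last n) = G ∧ (∀ k, IsFace e (f k)) ∧
        ∀ k : Fin n,
          (fdim (f k.castSucc) = fdim (f k.succ) + 1 ∨
            fdim (f k.succ) = fdim (f k.castSucc) + 1) ∧
          ((f k.castSucc ⊆ f k.succ ∧ SameMax e B (f k.castSucc) (f k.succ)) ∨
            (f k.succ ⊆ f k.castSucc ∧ SameMin e B (f k.castSucc) (f k.succ)))) := by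
  obtain ⟨b, hbc, rfl⟩ := isRegion_iff.1 hB
  have hb : ∀ i, 0 < ⟪e i, b⟫ := fun i =>
    lt_of_le_of_ne (hBpos i (self_mem_signCone e b)) (hbc i).symm
  have h13 : FWle e (signCone e b) F G ↔ ∀ i, covec e G i ≤ covec e F i := by
    obtain ⟨x, rfl⟩ := hF.exists_eq_signCone
    obtain ⟨y, rfl⟩ := hG.exists_eq_signCone
    simp only [covec_signCone, fwle_signCone_iff hb]
  refine ⟨h13, fun h => ?_, ?_⟩
  · have hchain : Relation.ReflTransGen (FaceStep e (signCone e b)) F G := by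
      obtain ⟨x, rfl⟩ := hF.exists_eq_signCone
      obtain ⟨y, rfl⟩ := hG.exists_eq_signCone
      exact reflTransGen_faceStep_of_sign_le hb _ x y ((fwle_signCone_iff hb).1 h) rfl
    obtain ⟨n, f, h0, hl, hf⟩ := exists_fin_chain_of_reflTransGen hchain
    refine ⟨n, f, h0, hl, fun k => ?_, fun k => (hf k).2⟩
    refine Fin.cases (h0 ▸ hF) (fun j => (hf j).1.2) k
  · rintro ⟨n, f, rfl, rfl, hface, hstep⟩
    refine h13.2 fun i => ?_
    have hanti : Antitone fun k => covec e (f k) i := by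
      refine Fin.antitone_iff_succ_le.2 fun k => ?_
      exact covec_le_of_step hb (hface _) (hface _) (hstep k).2 i
    exact hanti (Fin.zero_le _)
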